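/- If G is a path or a cycle with n edges, then φ(G) = ⌈n/2⌉ − ν(G), where φ(G) is the sparing number of G and ν(G) is the matching number of G. -/

import Mathlib

open Pointwise

/-- The induced set-label on unordered pairs: the sumset of the two vertex labels. -/
def edgeLabel {V : Type*} (f : V → Finset ℕ) : Sym2 V → Finset ℕ :=
  Sym2.lift ⟨fun u v => f u + f v, fun u v => add_comm (f u) (f v)⟩

/-- `f` is a weak integer additive set-indexer of `G`. -/
structure IsWeakIASI {V : Type*} (G : SimpleGraph V) (f : V → Finset ℕ) : Prop where
  nonempty : ∀ v, (f v).Nonempty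
  injective : Function.Injective f
  edgeInjective : Set.InjOn (edgeLabel f) G.edgeSet
  weak : ∀ u v, G.Adj u v → (edgeLabel f s(u, v)).card = max (f u).card (f v).card

/-- The number of mono-indexed edges of `G` under the labeling `f`. -/
noncomputable def monoEdgeCount {V : Type*} (G : SimpleGraph V) (f : V → Finset ℕ) : ℕ :=
  {e ∈ G.edgeSet | (edgeLabel f e).card = 1}.ncard

/-- The sparing number: the minimum number of mono-indexed edges over all weak IASIs. -/
noncomputable def sparingNumber {V : Type*} (G : SimpleGraph V) : ℕ :=
  sInf {n | ∃ f, IsWeakIASI G f ∧ monoEdgeCount G f = n}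

/-- The matching number of `G`: the size of a maximum matching. -/
noncomputable def matchingNumber {V : Type*} (G : SimpleGraph V) : ℕ :=
  sSup {n | ∃ M : G.Subgraph, M.IsMatching ∧ M.edgeSet.ncard = n}

section Aux

open Classical in
/-- The labelling used for upper bounds. -/
noncomputable def auxLabel {N : ℕ} (S : Set (Fin N)) (v : Fin N) : Finset ℕ :=
  if v ∈ S then {2 ^ (v : ℕ), 2 ^ (v : ℕ) + 1} else {2 ^ (v : ℕ)}

lemma auxLabel_mem {N : ℕ} (S : Set (Fin N)) (v : Fin N) : 2 ^ (v : ℕ) ∈ auxLabel S v := by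
  unfold auxLabel; split_ifs <;> simp

lemma auxLabel_le {N : ℕ} (S : Set (Fin N)) (v : Fin N) {x : ℕ} (hx : x ∈ auxLabel S v) :
    2 ^ (v : ℕ) ≤ x := by
  unfold auxLabel at hx
  split_ifs at hx
  · simp only [Finset.mem_insert, Finset.mem_singleton] at hx; omega
  · simp only [Finset.mem_singleton] at hx; omega

lemma auxLabel_sum_le {N : ℕ} (S : Set (Fin N)) (u v u' v' : Fin N)
    (h : auxLabel S u + auxLabel S v = auxLabel S u' + auxLabel S v') :
    2 ^ (u' : ℕ) + 2 ^ (v' : ℕ) ≤ 2 ^ (u : ℕ) + 2 ^ (v : ℕ) := by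
  have h1 : 2 ^ (u : ℕ) + 2 ^ (v : ℕ) ∈ auxLabel S u' + auxLabel S v' := by
    rw [← h]; exact Finset.add_mem_add (auxLabel_mem S u) (auxLabel_mem S v)
  obtain ⟨a, ha, b, hb, hab⟩ := Finset.mem_add.1 h1
  have := auxLabel_le S u' ha
  have := auxLabel_le S v' hb
  omega

lemma two_pow_pair {u v u' v' : ℕ} (h1 : u ≠ v) (h2 : u' ≠ v')
    (h : 2 ^ u + 2 ^ v = 2 ^ u' + 2 ^ v') : (u = u' ∧ v = v') ∨ (u = v' ∧ v = u') := by
  have h3 : ({u, v} : Finset ℕ) = {u', v'} := by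
    apply Finset.geomSum_injective (n := 2) le_rfl
    simpa [Finset.sum_pair h1, Finset.sum_pair h2] using h
  have hu : u ∈ ({u', v'} : Finset ℕ) := by rw [← h3]; simp
  have hv : v ∈ ({u', v'} : Finset ℕ) := by rw [← h3]; simp
  simp only [Finset.mem_insert, Finset.mem_singleton] at hu hv
  omega

lemma auxLabel_isWeak {N : ℕ} (G : SimpleGraph (Fin N)) (S : Set (Fin N))
    (hS : ∀ u v, G.Adj u v → u ∈ S → v ∉ S) : IsWeakIASI G (auxLabel S) := by
  refine ⟨fun v => ⟨_, auxLabel_mem S v⟩, ?_, ?_, ?_⟩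
  · intro u v h
    have h1 := auxLabel_le S v (h ▸ auxLabel_mem S u)
    have h2 := auxLabel_le S u (h ▸ auxLabel_mem S v)
    exact Fin.ext (Nat.pow_right_injective le_rfl (le_antisymm h2 h1))
  · intro e he e' he' h
    induction e using Sym2.ind with | _ u v => ?_
    induction e' using Sym2.ind with | _ u' v' => ?_
    have h0 : auxLabel S u + auxLabel S v = auxLabel S u' + auxLabel S v' := h
    have hne : (u : ℕ) ≠ v := fun hh => G.ne_of_adj he (Fin.ext hh)
    have hne' : (u' : ℕ) ≠ v' := fun hh => G.ne_of_adj he' (Fin.ext hh)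
    have := two_pow_pair hne hne'
      (le_antisymm (auxLabel_sum_le S _ _ _ _ h0.symm) (auxLabel_sum_le S _ _ _ _ h0))
    rw [Sym2.eq_iff]
    simpa [Fin.ext_iff] using this
  · intro u v huv
    change (auxLabel S u + auxLabel S v).card = _
    by_cases hu : u ∈ S
    · have hv := hS u v huv hu
      simp [auxLabel, hu, hv]
    · by_cases hv : v ∈ S <;> simp [auxLabel, hu, hv]

lemma sparing_le {N : ℕ} (G : SimpleGraph (Fin N)) (S : Set (Fin N)) (T : Set (Sym2 (Fin N)))
    (hS : ∀ u v, G.Adj u v → u ∈ S → v ∉ S)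
    (hT : ∀ u v, G.Adj u v → u ∉ S → v ∉ S → s(u, v) ∈ T) : sparingNumber G ≤ T.ncard := by
  have hw := auxLabel_isWeak G S hS
  have hle : sparingNumber G ≤ monoEdgeCount G (auxLabel S) :=
    Nat.sInf_le ⟨auxLabel S, hw, rfl⟩
  refine hle.trans ?_
  refine Set.ncard_le_ncard ?_ (Set.toFinite T)
  rintro e ⟨he, hc⟩
  induction e using Sym2.ind with | _ u v => ?_
  rw [hw.weak u v he] at hc
  apply hT u v he
  · intro hu
    have := le_max_left (auxLabel S u).card (auxLabel S v).card
    rw [hc] at this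
    simp [auxLabel, hu] at this
  · intro hv
    have := le_max_right (auxLabel S u).card (auxLabel S v).card
    rw [hc] at this
    simp [auxLabel, hv] at this

lemma colorable_of_sparing_zero {N : ℕ} (G : SimpleGraph (Fin N)) (f : Fin N → Finset ℕ)
    (hf : IsWeakIASI G f) (h : monoEdgeCount G f = 0) : G.Colorable 2 := by
  classical
  unfold monoEdgeCount at h
  rw [Set.ncard_eq_zero (Set.toFinite _)] at h
  refine ⟨SimpleGraph.Coloring.mk (fun v => if (f v).card = 1 then (0 : Fin 2) else 1) ?_⟩
  intro u v huv heq
  have h1 : (edgeLabel f s(u, v)).card ≠ 1 := by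
    intro hc
    have : s(u, v) ∈ ({e ∈ G.edgeSet | (edgeLabel f e).card = 1} : Set _) := ⟨huv, hc⟩
    rw [h] at this
    exact this
  have h2 := hf.weak u v huv
  have h3 : (f u).card + (f v).card - 1 ≤ (edgeLabel f s(u, v)).card :=
    cauchy_davenport_add_of_linearOrder_isCancelAdd (hf.nonempty u) (hf.nonempty v)
  have h4 := (hf.nonempty u).card_pos
  have h5 := (hf.nonempty v).card_pos
  by_cases hu : (f u).card = 1 <;> by_cases hv : (f v).card = 1 <;> simp [hu, hv] at heq <;>
    simp only [max_def] at h2 <;> split_ifs at h2 <;> omega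

lemma matching_bound {N : ℕ} (G : SimpleGraph (Fin N)) (M : G.Subgraph) (hM : M.IsMatching) :
    M.edgeSet.ncard ≤ N / 2 := by
  classical
  have h := M.spanningCoe.sum_degrees_eq_twice_card_edges
  have h2 : ∑ v, M.spanningCoe.degree v ≤ ∑ _v : Fin N, 1 := by
    apply Finset.sum_le_sum
    intro v _
    rw [← SimpleGraph.card_neighborFinset_eq_degree, Finset.card_le_one]
    intro a ha b hb
    simp only [SimpleGraph.mem_neighborFinset, SimpleGraph.Subgraph.spanningCoe_adj] at ha hb
    exact hM.eq_of_adj_left ha hb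
  have h3 : M.edgeSet.ncard = M.spanningCoe.edgeFinset.card := by
    rw [← SimpleGraph.Subgraph.edgeSet_spanningCoe, ← Set.ncard_coe_finset,
      SimpleGraph.coe_edgeFinset]
  simp only [Finset.sum_const, Finset.card_univ, Fintype.card_fin, smul_eq_mul, mul_one] at h2
  omega

/-- The matching `{2i, 2i+1}`. -/
def auxMatching {N : ℕ} (G : SimpleGraph (Fin N)) (hG : SimpleGraph.pathGraph N ≤ G) :
    G.Subgraph where
  verts := {v | (v : ℕ) / 2 * 2 + 1 < N}
  Adj u v := u ≠ v ∧ (u : ℕ) / 2 = (v : ℕ) / 2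
  adj_sub := by
    intro u v h
    apply hG
    rw [SimpleGraph.pathGraph_adj]
    have := h.2
    have h1 : (u : ℕ) ≠ v := fun hh => h.1 (Fin.ext hh)
    omega
  edge_vert := by
    intro u v h
    have := h.2
    have h1 : (u : ℕ) ≠ v := fun hh => h.1 (Fin.ext hh)
    have := u.2
    have := v.2
    change (u : ℕ) / 2 * 2 + 1 < N
    omega
  symm := ⟨fun u v h => ⟨h.1.symm, h.2.symm⟩⟩

lemma matchingNumber_eq {N : ℕ} (G : SimpleGraph (Fin N))
    (hG : SimpleGraph.pathGraph N ≤ G) : matchingNumber G = N / 2 := by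
  apply le_antisymm
  · apply csSup_le'
    rintro n ⟨M, hM, rfl⟩
    exact matching_bound G M hM
  · have hM : (auxMatching G hG).IsMatching := by
      intro v hv
      have hv' : (v : ℕ) / 2 * 2 + 1 < N := hv
      refine ⟨⟨(v : ℕ) / 2 * 2 + (1 - (v : ℕ) % 2), by omega⟩, ⟨?_, ?_⟩, ?_⟩
      · intro hh
        have := congrArg Fin.val hh
        simp only at this
        omega
      · simp only; omega
      · rintro w ⟨hw1, hw2⟩
        have h1 : (v : ℕ) ≠ w := fun hh => hw1 (Fin.ext hh)
        apply Fin.ext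
        simp only
        omega
    have hle : N / 2 ≤ (auxMatching G hG).edgeSet.ncard := by
      let g : Fin (N / 2) → Sym2 (Fin N) := fun i =>
        s(⟨2 * i, by have := i.2; omega⟩, ⟨2 * i + 1, by have := i.2; omega⟩)
      have hg : Function.Injective g := by
        intro i j hij
        simp only [g, Sym2.eq_iff, Fin.ext_iff] at hij
        apply Fin.ext
        omega
      have h1 : (Set.range g).ncard = N / 2 := by
        rw [← Set.image_univ, Set.ncard_image_of_injective _ hg, Set.ncard_univ]
        simp
      rw [← h1]
      refine Set.ncard_le_ncard ?_ (Set.toFinite _)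
      rintro _ ⟨i, rfl⟩
      refine ⟨?_, ?_⟩
      · simp [Fin.ext_iff]
      · simp only; omega
    refine hle.trans (le_csSup ⟨N / 2, ?_⟩ ⟨_, hM, rfl⟩)
    rintro n ⟨M, hM, rfl⟩
    exact matching_bound G M hM

lemma cycle_adj_cases {n : ℕ} {u v : Fin n} (h : (SimpleGraph.cycleGraph n).Adj u v) :
    (u : ℕ) + 1 = v ∨ (v : ℕ) + 1 = u ∨ ((u : ℕ) = 0 ∧ (v : ℕ) = n - 1) ∨
      ((v : ℕ) = 0 ∧ (u : ℕ) = n - 1) := by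
  rw [SimpleGraph.cycleGraph_adj'] at h
  have hu := u.2
  have hv := v.2
  rcases le_total u v with huv | huv
  · have h1 : (v - u).val = v.val - u.val := Fin.sub_val_of_le huv
    have h3 : u.val ≤ v.val := huv
    rcases h with h | h
    · rcases huv.eq_or_lt with h4 | h4
      · subst h4; omega
      · have h2 := Fin.coe_sub_iff_lt.2 h4
        omega
    · omega
  · have h1 : (u - v).val = u.val - v.val := Fin.sub_val_of_le huv
    have h3 : v.val ≤ u.val := huv
    rcases h with h | h
    · omega
    · rcases huv.eq_or_lt with h4 | h4
      · subst h4; omega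
      · have h2 := Fin.coe_sub_iff_lt.2 h4
        omega

end Aux

/-- If `G` is a path or a cycle with `n` edges, then `φ(G) = ⌈n/2⌉ - ν(G)`. -/
theorem sparingNumber_path_cycle_matchingNumber :
    (∀ n : ℕ, 1 ≤ n →
      sparingNumber (SimpleGraph.pathGraph (n + 1)) =
        (n + 1) / 2 - matchingNumber (SimpleGraph.pathGraph (n + 1))) ∧
    (∀ n : ℕ, 3 ≤ n →
      sparingNumber (SimpleGraph.cycleGraph n) =
        (n + 1) / 2 - matchingNumber (SimpleGraph.cycleGraph n)) := by
  constructor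
  · intro n _
    rw [matchingNumber_eq _ le_rfl, Nat.sub_self]
    have := sparing_le (SimpleGraph.pathGraph (n + 1)) {v | (v : ℕ) % 2 = 1} ∅ ?_ ?_
    · simpa using this
    · intro u v h hu hv
      rw [SimpleGraph.pathGraph_adj] at h
      simp only [Set.mem_ofPred_eq] at hu hv
      omega
    · intro u v h hu hv
      rw [SimpleGraph.pathGraph_adj] at h
      simp only [Set.mem_ofPred_eq] at hu hv
      omega
  · intro n hn
    rw [matchingNumber_eq _ SimpleGraph.pathGraph_le_cycleGraph]
    have hind : ∀ u v, (SimpleGraph.cycleGraph n).Adj u v →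
        u ∈ ({v | (v : ℕ) % 2 = 1} : Set (Fin n)) → v ∉ ({v | (v : ℕ) % 2 = 1} : Set (Fin n)) := by
      intro u v h hu hv
      have := cycle_adj_cases h
      simp only [Set.mem_ofPred_eq] at hu hv
      omega
    rcases Nat.even_or_odd n with he | ho
    · have := sparing_le (SimpleGraph.cycleGraph n) {v | (v : ℕ) % 2 = 1} ∅ hind ?_
      · rw [Set.ncard_empty] at this
        obtain ⟨k, rfl⟩ := he
        omega
      · intro u v h hu hv
        have := cycle_adj_cases h
        simp only [Set.mem_ofPred_eq] at hu hv
        obtain ⟨k, rfl⟩ := he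
        omega
    · have h1 := sparing_le (SimpleGraph.cycleGraph n) {v | (v : ℕ) % 2 = 1}
        {s(⟨0, by omega⟩, ⟨n - 1, by omega⟩)} hind ?_
      · rw [Set.ncard_singleton] at h1
        have h2 : sparingNumber (SimpleGraph.cycleGraph n) ≠ 0 := by
          intro h0
          have hne : {m | ∃ f, IsWeakIASI (SimpleGraph.cycleGraph n) f ∧
              monoEdgeCount (SimpleGraph.cycleGraph n) f = m}.Nonempty :=
            ⟨_, _, auxLabel_isWeak _ _ hind, rfl⟩
          obtain ⟨f, hf, hf0⟩ := Nat.sInf_mem hne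
          have hc := colorable_of_sparing_zero _ f hf (hf0.trans h0)
          have h3 := hc.chromaticNumber_le
          rw [SimpleGraph.chromaticNumber_cycleGraph_of_odd n (by omega) ho] at h3
          exact absurd h3 (by decide)
        obtain ⟨k, rfl⟩ := ho
        omega
      · intro u v h hu hv
        have := cycle_adj_cases h
        simp only [Set.mem_ofPred_eq] at hu hv
        simp only [Set.mem_singleton_iff, Sym2.eq_iff, Fin.ext_iff]
        obtain ⟨k, rfl⟩ := ho
        omega
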